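/- Let R be an rc-graph satisfying condition (*) and let 1 ≤ a₁ ≤ a₂ ≤ … ≤ a_m ≤ n be a weakly increasing sequence. Then there exist integers c₁,…,c_m and d₁,…,d_m with c_i > 0 ≥ d_i for each i and d₁ > d₂ > … > d_m, such that w_{R ← a₁a₂⋯a_m} = w_R·s_{c₁,d₁}⋯s_{c_m,d_m} and ℓ(w_R·s_{c₁,d₁}⋯s_{c_{m′},d_{m′}}) = ℓ(w_R) + m′ for every m′ ≤ m. -/

import Mathlib

open scoped Classical

noncomputable section

namespace RCGraphs

/-- The simple transposition `s j`, interchanging `j` and `j+1`. -/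
def sT (j : ℤ) : Equiv.Perm ℤ := Equiv.swap j (j + 1)

/-- The Coxeter length of a permutation of `ℤ`: the minimal length of an expression
as a product of simple transpositions. -/
def len (w : Equiv.Perm ℤ) : ℕ :=
  sInf {m : ℕ | ∃ l : List ℤ, l.length = m ∧ (l.map sT).prod = w}

/-- The permutations considered in the paper: bijections of `ℤ` fixing every `i > n`
and fixing all sufficiently small integers. -/
def IsPermZ (n : ℤ) (w : Equiv.Perm ℤ) : Prop :=
  (∀ i : ℤ, n < i → w i = i) ∧ ∃ N : ℤ, ∀ i : ℤ, i < N → w i = i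

/-- The reading order on positions `(i,k)`: rows (second coordinate) from `n` downward,
and within a row in order of increasing first coordinate. -/
def rcOrder (p q : ℤ × ℤ) : Prop :=
  q.2 < p.2 ∨ (p.2 = q.2 ∧ p.1 ≤ q.1)

instance : DecidableRel rcOrder := fun p q => by
  unfold rcOrder; infer_instance

instance : IsTrans (ℤ × ℤ) rcOrder :=
  ⟨fun a b c h₁ h₂ => by unfold rcOrder at *; omega⟩

instance : IsAntisymm (ℤ × ℤ) rcOrder :=
  ⟨fun a b h₁ h₂ => by
    unfold rcOrder at *
    have h3 : a.1 = b.1 ∧ a.2 = b.2 := by omega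
    exact Prod.ext h3.1 h3.2⟩

instance : IsTotal (ℤ × ℤ) rcOrder :=
  ⟨fun a b => by unfold rcOrder; omega⟩

/-- The permutation `w_R` associated to a finite set of positions `R`: the product of the
simple transpositions `s_{i+k-n-1}`, `(i,k) ∈ R`, in the reading order. -/
def wR (n : ℤ) (R : Finset (ℤ × ℤ)) : Equiv.Perm ℤ :=
  ((R.sort rcOrder).map fun p => sT (p.1 + p.2 - n - 1)).prod

/-- `R` is an rc-graph: positions lie in the grid `{(i,k) : i ≤ n, k ≤ n}` and the
reading word is reduced. -/
def IsRC (n : ℤ) (R : Finset (ℤ × ℤ)) : Prop :=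
  (∀ p ∈ R, p.1 ≤ n ∧ p.2 ≤ n) ∧ len (wR n R) = R.card

/-- Condition (*): `w_R(i) > w_R(i-1)` for all `i ≤ 0`; equivalently no two strands with
nonpositive labels cross. -/
def Star (n : ℤ) (R : Finset (ℤ × ℤ)) : Prop :=
  ∀ i : ℤ, i ≤ 0 → wR n R (i - 1) < wR n R i

/-- Strand labels in the wiring diagram of `R` (for diagrams all of whose crossings lie in
rows `k ≥ 1`, as is the case under condition (*)).  `lab n R true i k` is the label of the
strand entering position `(i,k)` from the west (the strand passing above, if `(i,k)` is not
a crossing); `lab n R false i k` is the label of the strand entering from the south (the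
strand passing below).  Each strand is labeled by the row where it begins. -/
def lab (n : ℤ) (R : Finset (ℤ × ℤ)) : Bool → ℤ → ℤ → ℤ
  | true, i, k =>
      if h : n ≤ i then k
      else if (i + 1, k) ∈ R then lab n R true (i + 1) k else lab n R false (i + 1) k
  | false, i, k =>
      if h : k ≤ 0 then i + k - n - 1
      else if (i, k - 1) ∈ R then lab n R false i (k - 1) else lab n R true i (k - 1)
  termination_by b i k => ((n - i).toNat + k.toNat)
  decreasing_by
    all_goals simp_wf
    all_goals omega

/-- The label of the strand leaving position `(i,r)` northward. -/
def northLabel (n : ℤ) (R : Finset (ℤ × ℤ)) (i r : ℤ) : ℤ :=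
  if (i, r) ∈ R then lab n R false i r else lab n R true i r

/-- `(i,k)` is an open space: not a crossing, the strand passing below it has a
nonpositive label and the strand passing above it has a positive label. -/
def OpenSpace (n : ℤ) (R : Finset (ℤ × ℤ)) (i k : ℤ) : Prop :=
  i ≤ n ∧ (i, k) ∉ R ∧ lab n R false i k ≤ 0 ∧ 0 < lab n R true i k

/-- The main loop of the Bergeron--Billey insertion algorithm, recording the trace:
the list of pairs (current diagram, crossing just added).  `R` always contains the
crossing `p` that was just added. -/
def insertSteps (n : ℤ) : ℕ → Finset (ℤ × ℤ) → ℤ × ℤ → List (Finset (ℤ × ℤ) × (ℤ × ℤ))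
  | 0, _, _ => []
  | fuel + 1, R, p =>
      (R, p) ::
        if IsRC n R then []
        else
          let a := lab n R true p.1 p.2
          let b := lab n R false p.1 p.2
          -- the unique other crossing of the two strands that cross at `p`
          let C := R.filter fun q =>
            q ≠ p ∧ ((lab n R true q.1 q.2 = a ∧ lab n R false q.1 q.2 = b) ∨
                     (lab n R true q.1 q.2 = b ∧ lab n R false q.1 q.2 = a))
          let q := (C.sort rcOrder).headI
          let R' := R.erase q
          let i' := sInf {x : ℤ | q.1 < x ∧ OpenSpace n R' x q.2}
          insertSteps n fuel (insert (i', q.2) R') (i', q.2)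

/-- The trace of the insertion of `k` into `R`: the states of the algorithm together with
the crossings added at each step. -/
def insertStepsOf (n : ℤ) (R : Finset (ℤ × ℤ)) (k : ℤ) : List (Finset (ℤ × ℤ) × (ℤ × ℤ)) :=
  let i₁ := sInf {x : ℤ | OpenSpace n R x k}
  insertSteps n ((n + 1 - k).toNat + 1) (insert (i₁, k) R) (i₁, k)

/-- The insertion `R ← k` of Bergeron and Billey. -/
def insertOne (n : ℤ) (R : Finset (ℤ × ℤ)) (k : ℤ) : Finset (ℤ × ℤ) :=
  ((insertStepsOf n R k).getLast?.getD (R, (0, 0))).1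

/-- The insertion `R ← v` of a word. -/
def insertWord (n : ℤ) (R : Finset (ℤ × ℤ)) (v : List ℕ) : Finset (ℤ × ℤ) :=
  v.foldl (fun S a => insertOne n S (a : ℤ)) R

/-- The column (first coordinate) at which the strand labeled `a` of the diagram `R`
leaves row `r` northward. -/
def strandCol (n : ℤ) (R : Finset (ℤ × ℤ)) (a r : ℤ) : ℤ :=
  sSup {i : ℤ | i ≤ n ∧ northLabel n R i r = a}

/-- Given the trace `L` of an insertion, the column occupied in row `r` by the left path
(`left = true`) or the right path (`left = false`) of the insertion.  Between the rows of
the `t`-th and `(t+1)`-st added crossings, the left path is the piece `s_t` of the strand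
whose label changes from `a_t` to `b_t`, and the right path is the piece `s^t` whose label
changes from `b_t` to `a_t`. -/
def pathCol (n : ℤ) (L : List (Finset (ℤ × ℤ) × (ℤ × ℤ))) (left : Bool) (r : ℤ) : ℤ :=
  match (L.filter fun e => e.2.2 ≤ r).getLast? with
  | some e => strandCol n e.1 (lab n e.1 left e.2.1 e.2.2) r
  | none => 0

/-- A semistandard Young tableau with at most `n` rows (rows indexed `1,…,n`, row `j`
having `μ j` boxes, columns indexed from `0`), with entries in `{1,…,n}`, weakly
increasing along rows and strictly increasing down columns; entries outside the shape
are `0`. -/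
structure SSYT (n : ℕ) (μ : ℕ → ℕ) where
  entry : ℕ → ℕ → ℕ
  entry_mem : ∀ j c, 1 ≤ j → j ≤ n → c < μ j → 1 ≤ entry j c ∧ entry j c ≤ n
  row_weak : ∀ j c₁ c₂, 1 ≤ j → j ≤ n → c₁ ≤ c₂ → c₂ < μ j → entry j c₁ ≤ entry j c₂
  col_strict : ∀ j₁ j₂ c, 1 ≤ j₁ → j₁ < j₂ → j₂ ≤ n → c < μ j₂ → entry j₁ c < entry j₂ c
  outside : ∀ j c, j = 0 ∨ n < j ∨ μ j ≤ c → entry j c = 0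

/-- `μ` is a partition with (at most) `n` parts `μ 1 ≥ μ 2 ≥ … ≥ μ n ≥ 0`
(and `μ j = 0` outside `1,…,n`). -/
def IsPartition (n : ℕ) (μ : ℕ → ℕ) : Prop :=
  (∀ j, 1 ≤ j → j < n → μ (j + 1) ≤ μ j) ∧ ∀ j, j = 0 ∨ n < j → μ j = 0

/-- The reading word of a tableau: the rows read left to right, from the bottom row
to the top one. -/
def readingWord (n : ℕ) (μ : ℕ → ℕ) (Y : SSYT n μ) : List ℕ :=
  ((List.range n).reverse.map (· + 1)).flatMap fun j =>
    (List.range (μ j)).map fun c => Y.entry j c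

/-- An elementary Knuth move. -/
def KnuthMove (w₁ w₂ : List ℕ) : Prop :=
  (∃ (u v : List ℕ) (x y z : ℕ), x < y ∧ y ≤ z ∧
      w₁ = u ++ y :: x :: z :: v ∧ w₂ = u ++ y :: z :: x :: v) ∨
  (∃ (u v : List ℕ) (x y z : ℕ), x ≤ y ∧ y < z ∧
      w₁ = u ++ x :: z :: y :: v ∧ w₂ = u ++ z :: x :: y :: v)

/-- Knuth equivalence: the equivalence relation generated by elementary Knuth moves. -/
def KnuthEquiv (w₁ w₂ : List ℕ) : Prop := Relation.EqvGen KnuthMove w₁ w₂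

/-- The monomial `x^R = ∏_{(i,k) ∈ R} x_k`. -/
def xR (R : Finset (ℤ × ℤ)) : MvPolynomial ℕ ℤ :=
  ∏ p ∈ R, MvPolynomial.X p.2.toNat

/-- The monomial `x^Y = ∏ x_i`, one factor for each entry `i` of `Y`. -/
def xY (n : ℕ) (μ : ℕ → ℕ) (Y : SSYT n μ) : MvPolynomial ℕ ℤ :=
  ((readingWord n μ Y).map MvPolynomial.X).prod

/-- The Schubert polynomial `S_w = Σ_{R : w_R = w} x^R`. -/
def Schub (n : ℤ) (w : Equiv.Perm ℤ) : MvPolynomial ℕ ℤ :=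
  ∑ᶠ R ∈ {R : Finset (ℤ × ℤ) | IsRC n R ∧ wR n R = w}, xR R

/-- The Schur polynomial `s_μ(x₁,…,x_n) = Σ_Y x^Y`, summing over all semistandard Young
tableaux of shape `μ` with entries in `{1,…,n}`. -/
def SchurP (n : ℕ) (μ : ℕ → ℕ) : MvPolynomial ℕ ℤ :=
  ∑ᶠ Y : SSYT n μ, xY n μ Y

/-- The complete homogeneous symmetric polynomial
`h_m = Σ_{1 ≤ i₁ ≤ … ≤ i_m ≤ n} x_{i₁} ⋯ x_{i_m}`. -/
def hPoly (n m : ℕ) : MvPolynomial ℕ ℤ :=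
  ∑ s ∈ (Finset.Icc 1 n).sym m, (s.1.map MvPolynomial.X).prod

/-- The top rc-graph `R(μ) = {(i,k) : 1 ≤ k ≤ n, n - μ_k + 1 ≤ i ≤ n}` of a partition. -/
def Rmu (n : ℕ) (μ : ℕ → ℕ) : Finset (ℤ × ℤ) :=
  (Finset.Icc 1 (n : ℤ)).biUnion fun k =>
    (Finset.Icc ((n : ℤ) - μ k.toNat + 1) (n : ℤ)).image fun i => (i, k)


def Aft (p r : ℤ × ℤ) : Prop := r.2 < p.2 ∨ (r.2 = p.2 ∧ p.1 < r.1)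

lemma Aft.trans {p q r : ℤ × ℤ} (h : Aft p q) (h' : Aft q r) : Aft p r := by
  unfold Aft at *; omega

lemma Aft.irrefl (p : ℤ × ℤ) : ¬ Aft p p := by
  unfold Aft; omega

lemma Aft.tri {p q : ℤ × ℤ} (h : p ≠ q) : Aft p q ∨ Aft q p := by
  by_contra hc
  apply h
  unfold Aft at hc
  ext <;> omega

/-- Peeling induction: remove the first element in the reading order. -/
lemma peel {P : Finset (ℤ × ℤ) → Prop} (h0 : P ∅)
    (hs : ∀ r F, r ∉ F → (∀ x ∈ F, Aft r x) → P F → P (insert r F)) : ∀ F, P F := by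
  intro F
  refine Finset.induction_on_max_value (fun r : ℤ × ℤ => toLex (r.2, -r.1)) F h0 ?_
  intro a s ha hm hP
  refine hs a s ha ?_ hP
  intro x hx
  have h1 := hm x hx
  rw [Prod.Lex.toLex_le_toLex] at h1
  have hne : x ≠ a := by rintro rfl; exact ha hx
  rcases Aft.tri hne with h | h
  · unfold Aft at h; simp at h1; omega
  · exact h

lemma wR_empty (n : ℤ) : wR n ∅ = 1 := by simp [wR]

lemma wR_insert (n : ℤ) (r : ℤ × ℤ) (F : Finset (ℤ × ℤ)) (h : ∀ x ∈ F, Aft r x) :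
    wR n (insert r F) = sT (r.1 + r.2 - n - 1) * wR n F := by
  unfold wR
  have h2 : r ∉ F := fun hr => Aft.irrefl r (h r hr)
  rw [Finset.sort_insert]
  · simp
  · intro b hb
    have := h b hb
    unfold Aft at this
    unfold rcOrder
    omega
  · exact h2

lemma wR_union (n : ℤ) (A B : Finset (ℤ × ℤ)) (h : ∀ a ∈ A, ∀ b ∈ B, Aft a b) :
    wR n (A ∪ B) = wR n A * wR n B := by
  revert h
  refine peel (P := fun A => (∀ a ∈ A, ∀ b ∈ B, Aft a b) → wR n (A ∪ B) = wR n A * wR n B)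
    ?_ ?_ A
  · intro _; simp [wR_empty]
  · intro r F hr hF ih h
    rw [Finset.insert_union, wR_insert, wR_insert _ _ _ hF, ih, mul_assoc]
    · intro a ha b hb; exact h a (by simp [ha]) b hb
    · intro x hx
      rcases Finset.mem_union.1 hx with hx | hx
      · exact hF x hx
      · exact h r (by simp) x hx

lemma wR_fix (n : ℤ) (F : Finset (ℤ × ℤ)) (x : ℤ)
    (h : ∀ r ∈ F, x ≠ r.1 + r.2 - n - 1 ∧ x ≠ r.1 + r.2 - n) : wR n F x = x := by
  revert h
  refine peel (P := fun F => (∀ r ∈ F, x ≠ r.1 + r.2 - n - 1 ∧ x ≠ r.1 + r.2 - n) →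
    wR n F x = x) ?_ ?_ F
  · intro _; simp [wR_empty]
  · intro r F hr hF ih h
    rw [wR_insert _ _ _ hF, Equiv.Perm.mul_apply, ih (fun a ha => h a (by simp [ha]))]
    have := h r (by simp)
    unfold sT
    apply Equiv.swap_apply_of_ne_of_ne <;> omega

lemma inv_fix {w : Equiv.Perm ℤ} {x : ℤ} (h : w x = x) : w⁻¹ x = x := by
  rw [Equiv.Perm.inv_eq_iff_eq, h]

/-- The partial product of crossings read after `p`. -/
def U (n : ℤ) (R : Finset (ℤ × ℤ)) (p : ℤ × ℤ) : Equiv.Perm ℤ := wR n (R.filter (Aft p))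

lemma U_split (n : ℤ) (R : Finset (ℤ × ℤ)) (s s' : ℤ × ℤ) (h : ∀ r, Aft s' r → Aft s r) :
    U n R s = wR n (R.filter fun r => Aft s r ∧ ¬ Aft s' r) * U n R s' := by
  unfold U
  rw [← wR_union]
  · congr 1
    ext r
    have := h r
    simp only [Finset.mem_filter, Finset.mem_union]
    by_cases h1 : Aft s' r <;> tauto
  · intro a ha b hb
    simp only [Finset.mem_filter] at ha hb
    have h1 := ha.2.2
    have h2 := hb.2
    unfold Aft at *
    omega

lemma sT_mul (j : ℤ) (u : Equiv.Perm ℤ) :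
    sT j * u = u * Equiv.swap (u⁻¹ (j + 1)) (u⁻¹ j) := by
  rw [Equiv.mul_swap_eq_swap_mul, Equiv.swap_comm]
  simp [sT]

/-- label entering from the west -/
def lt' (n : ℤ) (R : Finset (ℤ × ℤ)) (p : ℤ × ℤ) : ℤ := (U n R p)⁻¹ (p.1 + p.2 - n)
/-- label entering from the south -/
def lf' (n : ℤ) (R : Finset (ℤ × ℤ)) (p : ℤ × ℤ) : ℤ := (U n R p)⁻¹ (p.1 + p.2 - n - 1)

lemma U_lt (n R p) : U n R p (lt' n R p) = p.1 + p.2 - n := by simp [lt']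
lemma U_lf (n R p) : U n R p (lf' n R p) = p.1 + p.2 - n - 1 := by simp [lf']

lemma U_insert_not (n : ℤ) (R : Finset (ℤ × ℤ)) (p s : ℤ × ℤ) (h : ¬ Aft s p) :
    U n (insert p R) s = U n R s := by
  unfold U
  rw [Finset.filter_insert, if_neg h]

lemma U_insert (n : ℤ) (R : Finset (ℤ × ℤ)) (p s : ℤ × ℤ) (hp : p ∉ R) (h : Aft s p) :
    U n (insert p R) s = U n R s * Equiv.swap (lt' n R p) (lf' n R p) := by
  have e1 : (insert p R).filter (Aft s) =
      (R.filter fun r => Aft s r ∧ ¬ Aft p r) ∪ insert p (R.filter (Aft p)) := by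
    ext r
    have := @Aft.trans s p r h
    simp only [Finset.mem_filter, Finset.mem_union, Finset.mem_insert]
    constructor
    · by_cases h1 : Aft p r <;> tauto
    · rintro (h1 | h1 | h1)
      · tauto
      · subst h1; tauto
      · tauto
  have hs := U_split n R s p (fun r hr => h.trans hr)
  rw [hs]
  conv_lhs => unfold U
  rw [e1, wR_union, wR_insert, sT_mul, mul_assoc]
  · unfold lt' lf' U
    simp
  · intro x hx; exact (Finset.mem_filter.1 hx).2
  · intro a ha b hb
    simp only [Finset.mem_filter, Finset.mem_insert] at ha hb
    have hne : p ≠ a := by rintro rfl; exact hp ha.1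
    have hap : Aft a p := (Aft.tri hne).resolve_left ha.2.2
    rcases hb with rfl | hb
    · exact hap
    · exact hap.trans hb.2

/-! Inversions and length -/

def Inv (w : Equiv.Perm ℤ) : Set (ℤ × ℤ) := {q | q.1 < q.2 ∧ w q.2 < w q.1}

lemma sT_apply (j x : ℤ) : sT j x = if x = j then j + 1 else if x = j + 1 then j else x := by
  unfold sT; exact Equiv.swap_apply_def _ _ _

lemma Inv_up (u : Equiv.Perm ℤ) (j : ℤ) (h : u⁻¹ j < u⁻¹ (j + 1)) :
    Inv (sT j * u) = insert (u⁻¹ j, u⁻¹ (j + 1)) (Inv u) ∧ (u⁻¹ j, u⁻¹ (j + 1)) ∉ Inv u := by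
  constructor
  · ext ⟨x, y⟩
    simp only [Inv, Set.mem_ofPred_eq, Set.mem_insert_iff, Equiv.Perm.mul_apply, sT_apply,
      Prod.mk.injEq]
    rw [Equiv.Perm.eq_inv_iff_eq, Equiv.Perm.eq_inv_iff_eq]
    have h1 : u x = j → u y = j + 1 → x < y := by
      intro a b; have e1 : u⁻¹ j = _ := (Equiv.Perm.inv_eq_iff_eq.2 a.symm)
      have e2 : u⁻¹ (j + 1) = _ := (Equiv.Perm.inv_eq_iff_eq.2 b.symm)
      rwa [e1, e2] at h
    have h2 : u y = j → u x = j + 1 → y < x := by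
      intro a b; have e1 : u⁻¹ j = _ := (Equiv.Perm.inv_eq_iff_eq.2 a.symm)
      have e2 : u⁻¹ (j + 1) = _ := (Equiv.Perm.inv_eq_iff_eq.2 b.symm)
      rwa [e1, e2] at h
    have h3 : u x = u y → x = y := fun e => u.injective e
    split_ifs <;> constructor <;> intro hh <;> omega
  · simp [Inv]

lemma Inv_down (u : Equiv.Perm ℤ) (j : ℤ) (h : u⁻¹ (j + 1) < u⁻¹ j) :
    Inv u = insert (u⁻¹ (j + 1), u⁻¹ j) (Inv (sT j * u)) ∧
      (u⁻¹ (j + 1), u⁻¹ j) ∉ Inv (sT j * u) := by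
  have h1 : sT j * (sT j * u) = u := by
    rw [← mul_assoc]; simp [sT]
  have hi : (sT j * u)⁻¹ = u⁻¹ * sT j := by simp [sT, mul_inv_rev]
  have e1 : (sT j * u)⁻¹ j = u⁻¹ (j + 1) := by rw [hi]; simp [sT]
  have e2 : (sT j * u)⁻¹ (j + 1) = u⁻¹ j := by rw [hi]; simp [sT]
  have := Inv_up (sT j * u) j (by rw [e1, e2]; exact h)
  rw [e1, e2, h1] at this
  exact this
lemma Inv_one : Inv 1 = ∅ := by
  ext ⟨x, y⟩
  simp [Inv]
  omega

lemma inv_lt_or (u : Equiv.Perm ℤ) (j : ℤ) : u⁻¹ j < u⁻¹ (j + 1) ∨ u⁻¹ (j + 1) < u⁻¹ j := by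
  have : u⁻¹ j ≠ u⁻¹ (j + 1) := by
    intro h
    have := (u⁻¹).injective h
    omega
  omega

lemma list_Inv (l : List ℤ) :
    (Inv (l.map sT).prod).Finite ∧ (Inv (l.map sT).prod).ncard ≤ l.length := by
  induction l with
  | nil => simp [Inv_one]
  | cons j l ih =>
    simp only [List.map_cons, List.prod_cons, List.length_cons]
    rcases inv_lt_or (l.map sT).prod j with h | h
    · obtain ⟨h1, h2⟩ := Inv_up _ _ h
      rw [h1]
      refine ⟨ih.1.insert _, ?_⟩
      have := Set.ncard_insert_le ((l.map sT).prod⁻¹ j, (l.map sT).prod⁻¹ (j + 1))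
        (Inv (l.map sT).prod)
      omega
    · obtain ⟨h1, h2⟩ := Inv_down _ _ h
      have hsub : Inv (sT j * (l.map sT).prod) ⊆ Inv (l.map sT).prod := by
        conv_rhs => rw [h1]
        exact Set.subset_insert _ _
      refine ⟨ih.1.subset hsub, ?_⟩
      have := Set.ncard_le_ncard hsub ih.1
      omega

lemma eq_one_of_Inv (w : Equiv.Perm ℤ) (h : Inv w = ∅) (M : ℤ) (hM : ∀ x, M < x → w x = x) :
    w = 1 := by
  have hmono : ∀ x y, x < y → w x < w y := by
    intro x y hxy
    have h1 : (x, y) ∉ Inv w := by rw [h]; simp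
    have h2 : w x ≠ w y := fun e => by have := w.injective e; omega
    simp only [Inv, Set.mem_ofPred_eq, not_and, not_lt] at h1
    have := h1 hxy
    omega
  have key : ∀ d : ℕ, w (M + 1 - d) = M + 1 - d := by
    intro d
    induction d with
    | zero => apply hM; simp
    | succ d ih =>
      set x := M + 1 - ((d + 1 : ℕ) : ℤ) with hx
      have e : M + 1 - (d : ℤ) = x + 1 := by push_cast at hx; omega
      rw [e] at ih
      have h1 := hmono x (x + 1) (by omega)
      by_contra hne
      obtain ⟨y, hy⟩ := w.surjective x
      rcases lt_trichotomy y x with h2 | h2 | h2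
      · have := hmono y x h2; omega
      · subst h2; exact hne hy
      · rcases eq_or_lt_of_le (show x + 1 ≤ y by omega) with h3 | h3
        · rw [← h3] at hy; omega
        · have := hmono _ _ h3; omega
  ext x
  by_cases hx : M < x
  · simp [hM x hx]
  · have := key (M + 1 - x).toNat
    have e : M + 1 - ((M + 1 - x).toNat : ℤ) = x := by omega
    rw [e] at this
    simpa using this

lemma exists_word (N : ℕ) : ∀ (w : Equiv.Perm ℤ), (Inv w).Finite → (Inv w).ncard = N →
    (∃ M, ∀ x, M < x → w x = x) → ∃ l : List ℤ, l.length = N ∧ (l.map sT).prod = w := by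
  induction N with
  | zero =>
    rintro w hf h0 ⟨M, hM⟩
    refine ⟨[], rfl, ?_⟩
    rw [Set.ncard_eq_zero hf] at h0
    simp [eq_one_of_Inv w h0 M hM]
  | succ N ih =>
    rintro w hf hN ⟨M, hM⟩
    have : ∃ j, w⁻¹ (j + 1) < w⁻¹ j := by
      by_contra hc
      push Not at hc
      have hs : StrictMono (w⁻¹ : Equiv.Perm ℤ) := by
        apply strictMono_int_of_lt_succ
        intro j
        have := hc j
        have := inv_lt_or w j
        omega
      have : Inv w = ∅ := by
        ext ⟨x, y⟩
        simp only [Inv, Set.mem_ofPred_eq, Set.mem_empty_iff_false, iff_false, not_and]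
        intro h1 h2
        have := hs h2
        simp at this
        omega
      rw [this] at hN
      simp at hN
    obtain ⟨j, hj⟩ := this
    obtain ⟨h1, h2⟩ := Inv_down _ _ hj
    have hsub : Inv (sT j * w) ⊆ Inv w := by
      conv_rhs => rw [h1]
      exact Set.subset_insert _ _
    have hf' := hf.subset hsub
    have hc : (Inv (sT j * w)).ncard = N := by
      have := Set.ncard_insert_of_notMem h2 hf'
      rw [← h1] at this
      omega
    obtain ⟨l, hl, hl'⟩ := ih (sT j * w) hf' hc ⟨max M (j + 1), fun x hx => by
      rw [Equiv.Perm.mul_apply, hM x (by omega), sT_apply]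
      split_ifs <;> omega⟩
    refine ⟨j :: l, by simp [hl], ?_⟩
    simp only [List.map_cons, List.prod_cons, hl']
    rw [← mul_assoc]; simp [sT]

lemma list_fix (l : List ℤ) : ∃ M, ∀ x, M < x → (l.map sT).prod x = x := by
  induction l with
  | nil => simp
  | cons j l ih =>
    obtain ⟨M, hM⟩ := ih
    refine ⟨max M (j + 1), fun x hx => ?_⟩
    simp only [List.map_cons, List.prod_cons]
    rw [Equiv.Perm.mul_apply, hM x (by omega), sT_apply]
    split_ifs <;> omega

lemma len_eq (l : List ℤ) : len (l.map sT).prod = (Inv (l.map sT).prod).ncard := by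
  unfold len
  apply le_antisymm
  · apply Nat.sInf_le
    exact exists_word _ _ (list_Inv l).1 rfl (list_fix l)
  · apply le_csInf
    · exact ⟨_, l, rfl, rfl⟩
    · rintro m ⟨l', rfl, h⟩
      rw [← h]
      exact (list_Inv l').2

lemma wR_list (n : ℤ) (R) : ∃ l : List ℤ, wR n R = (l.map sT).prod := by
  refine ⟨(R.sort rcOrder).map fun p => p.1 + p.2 - n - 1, ?_⟩
  simp [wR, Function.comp_def]

lemma len_wR (n : ℤ) (R) : len (wR n R) = (Inv (wR n R)).ncard ∧ (Inv (wR n R)).Finite := by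
  obtain ⟨l, hl⟩ := wR_list n R
  rw [hl]
  exact ⟨len_eq l, (list_Inv l).1⟩

def Good (n : ℤ) (R : Finset (ℤ × ℤ)) : Prop := ∀ r ∈ R, lf' n R r < lt' n R r

lemma lf_ne_lt (n R r) : lf' n R r ≠ lt' n R r := by
  unfold lf' lt'
  intro h
  have := (U n R r)⁻¹.injective h
  omega

lemma U_first (n : ℤ) (r : ℤ × ℤ) (F : Finset (ℤ × ℤ)) (hF : ∀ x ∈ F, Aft r x) :
    U n (insert r F) r = wR n F := by
  unfold U
  congr 1
  ext x
  simp only [Finset.mem_filter, Finset.mem_insert]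
  constructor
  · rintro ⟨rfl | h, h2⟩
    · exact absurd h2 (Aft.irrefl _)
    · exact h
  · intro h; exact ⟨Or.inr h, hF x h⟩

lemma U_rest (n : ℤ) (r : ℤ × ℤ) (F : Finset (ℤ × ℤ)) (hF : ∀ x ∈ F, Aft r x) (x) (hx : x ∈ F) :
    U n (insert r F) x = U n F x := by
  apply U_insert_not
  intro h
  exact Aft.irrefl _ (h.trans (hF x hx))

lemma good_insert (n : ℤ) (r : ℤ × ℤ) (F : Finset (ℤ × ℤ)) (hF : ∀ x ∈ F, Aft r x) :
    Good n (insert r F) ↔ Good n F ∧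
      (wR n F)⁻¹ (r.1 + r.2 - n - 1) < (wR n F)⁻¹ (r.1 + r.2 - n) := by
  unfold Good
  rw [Finset.forall_mem_insert]
  have h1 : lf' n (insert r F) r = (wR n F)⁻¹ (r.1 + r.2 - n - 1) := by
    unfold lf'; rw [U_first n r F hF]
  have h2 : lt' n (insert r F) r = (wR n F)⁻¹ (r.1 + r.2 - n) := by
    unfold lt'; rw [U_first n r F hF]
  rw [h1, h2, and_comm]
  apply and_congr_left'
  apply forall₂_congr
  intro x hx
  unfold lf' lt'
  rw [U_rest n r F hF x hx]

lemma good_card (n : ℤ) (R : Finset (ℤ × ℤ)) :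
    (Inv (wR n R)).ncard ≤ R.card ∧ ((Inv (wR n R)).ncard = R.card ↔ Good n R) := by
  refine peel (P := fun R => (Inv (wR n R)).ncard ≤ R.card ∧
    ((Inv (wR n R)).ncard = R.card ↔ Good n R)) ?_ ?_ R
  · simp [wR_empty, Inv_one, Good]
  · intro r F hr hF ih
    have hfin := (len_wR n F).2
    rw [good_insert n r F hF, wR_insert n r F hF, Finset.card_insert_of_notMem hr]
    have e : r.1 + r.2 - n - 1 + 1 = r.1 + r.2 - n := by ring
    rcases inv_lt_or (wR n F) (r.1 + r.2 - n - 1) with h | h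
    · obtain ⟨h1, h2⟩ := Inv_up _ _ h
      have h3 := Set.ncard_insert_of_notMem h2 hfin
      rw [← h1] at h3
      rw [e] at h
      rw [h3]
      refine ⟨by omega, ?_⟩
      rw [← ih.2]
      constructor
      · intro h'; exact ⟨by omega, h⟩
      · intro h'; have := h'.1; omega
    · obtain ⟨h1, h2⟩ := Inv_down _ _ h
      have hsub : Inv (sT (r.1 + r.2 - n - 1) * wR n F) ⊆ Inv (wR n F) := by
        conv_rhs => rw [h1]
        exact Set.subset_insert _ _
      have := Set.ncard_le_ncard hsub hfin
      rw [e] at h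
      refine ⟨by omega, ?_⟩
      constructor
      · intro h; omega
      · rintro ⟨_, h'⟩; omega

lemma isRC_iff (n : ℤ) (R : Finset (ℤ × ℤ)) :
    IsRC n R ↔ (∀ p ∈ R, p.1 ≤ n ∧ p.2 ≤ n) ∧ Good n R := by
  unfold IsRC
  rw [(len_wR n R).1, (good_card n R).2]

lemma inv_char_w (n : ℤ) (R : Finset (ℤ × ℤ)) (hR : Good n R) (x y : ℤ) (hxy : x < y) :
    wR n R y < wR n R x ↔ ∃ r ∈ R, lf' n R r = x ∧ lt' n R r = y := by
  revert hR
  refine peel (P := fun R => Good n R →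
    (wR n R y < wR n R x ↔ ∃ r ∈ R, lf' n R r = x ∧ lt' n R r = y)) ?_ ?_ R
  · intro _; simp [wR_empty]; omega
  · intro r F hr hF ih hG
    have e : r.1 + r.2 - n - 1 + 1 = r.1 + r.2 - n := by ring
    obtain ⟨hG1, hG2⟩ := (good_insert n r F hF).1 hG
    have ih := ih hG1
    have h1 : lf' n (insert r F) r = (wR n F)⁻¹ (r.1 + r.2 - n - 1) := by
      unfold lf'; rw [U_first n r F hF]
    have h2 : lt' n (insert r F) r = (wR n F)⁻¹ (r.1 + r.2 - n) := by
      unfold lt'; rw [U_first n r F hF]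
    rw [Finset.exists_mem_insert, h1, h2, wR_insert n r F hF]
    have hu := (Inv_up (wR n F) (r.1 + r.2 - n - 1) (by rw [e]; exact hG2)).1
    rw [e] at hu
    have hm : (x, y) ∈ Inv (sT (r.1 + r.2 - n - 1) * wR n F) ↔
      (x, y) = ((wR n F)⁻¹ (r.1 + r.2 - n - 1), (wR n F)⁻¹ (r.1 + r.2 - n)) ∨
        (x, y) ∈ Inv (wR n F) := by rw [hu]; simp
    simp only [Inv, Set.mem_ofPred_eq, hxy, true_and, Prod.mk.injEq] at hm
    rw [hm, ih]
    apply or_congr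
    · constructor <;> rintro ⟨a, b⟩ <;> exact ⟨a.symm, b.symm⟩
    · apply exists_congr
      intro s
      apply and_congr_right
      intro hs
      unfold lf' lt'
      rw [U_rest n r F hF s hs]

lemma U_filter (n : ℤ) (R : Finset (ℤ × ℤ)) (s r : ℤ × ℤ) (h : Aft s r) :
    U n (R.filter (Aft s)) r = U n R r := by
  unfold U
  rw [Finset.filter_filter]
  congr 1
  apply Finset.filter_congr
  intro x _
  exact ⟨fun h => h.2, fun h' => ⟨h.trans h', h'⟩⟩

lemma inv_char (n : ℤ) (R : Finset (ℤ × ℤ)) (hR : Good n R) (s : ℤ × ℤ) (x y : ℤ) (hxy : x < y) :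
    U n R s y < U n R s x ↔ ∃ r ∈ R, Aft s r ∧ lf' n R r = x ∧ lt' n R r = y := by
  have hG : Good n (R.filter (Aft s)) := by
    intro r hr
    obtain ⟨h1, h2⟩ := Finset.mem_filter.1 hr
    have := hR r h1
    unfold lf' lt' at *
    rwa [U_filter n R s r h2]
  have := inv_char_w n _ hG x y hxy
  unfold U
  rw [this]
  apply exists_congr
  intro r
  rw [Finset.mem_filter, and_assoc]
  apply and_congr_right
  intro _
  apply and_congr_right
  intro h
  unfold lf' lt'
  rw [U_filter n R s r h]

lemma inv_mono (n : ℤ) (R : Finset (ℤ × ℤ)) (hR : Good n R) (s s' : ℤ × ℤ)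
    (h : ∀ r, Aft s' r → Aft s r) (x y : ℤ) (hxy : x < y) (hi : U n R s' y < U n R s' x) :
    U n R s y < U n R s x := by
  rw [inv_char n R hR _ x y hxy] at *
  obtain ⟨r, h1, h2, h3⟩ := hi
  exact ⟨r, h1, h r h2, h3⟩

lemma inv_mono_w (n : ℤ) (R : Finset (ℤ × ℤ)) (hR : Good n R) (s : ℤ × ℤ)
    (x y : ℤ) (hxy : x < y) (hi : U n R s y < U n R s x) :
    wR n R y < wR n R x := by
  rw [inv_char n R hR _ x y hxy] at hi
  rw [inv_char_w n R hR x y hxy]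
  obtain ⟨r, h1, h2, h3⟩ := hi
  exact ⟨r, h1, h3⟩

lemma star_mono (n : ℤ) (R : Finset (ℤ × ℤ)) (hS : Star n R) (x y : ℤ) (hxy : x < y)
    (hy : y ≤ 0) : wR n R x < wR n R y := by
  have : ∀ d : ℕ, y - (d + 1 : ℕ) < y ∧ wR n R (y - (d + 1 : ℕ)) < wR n R y := by
    intro d
    induction d with
    | zero => exact ⟨by simp, by simpa using hS y hy⟩
    | succ d ih =>
      refine ⟨by push_cast; omega, lt_trans ?_ ih.2⟩
      have := hS (y - (d + 1 : ℕ)) (by push_cast; omega)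
      have e : y - ((d + 1 : ℕ) : ℤ) - 1 = y - ((d + 1 + 1 : ℕ) : ℤ) := by push_cast; ring
      rwa [e] at this
  have h := (this (y - x - 1).toNat).2
  have e : y - (((y - x - 1).toNat + 1 : ℕ) : ℤ) = x := by push_cast; omega
  rwa [e] at h

lemma star_U (n : ℤ) (R : Finset (ℤ × ℤ)) (hG : Good n R) (hS : Star n R) (s) (x y : ℤ)
    (hxy : x < y) (hy : y ≤ 0) : U n R s x < U n R s y := by
  by_contra hc
  have h1 : U n R s x ≠ U n R s y := fun e => by have := (U n R s).injective e; omega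
  have := inv_mono_w n R hG s x y hxy (by omega)
  have := star_mono n R hS x y hxy hy
  omega

lemma star_U_lt (n : ℤ) (R : Finset (ℤ × ℤ)) (hG : Good n R) (hS : Star n R) (s) (x y : ℤ)
    (hx : x ≤ 0) (hy : y ≤ 0) (h : U n R s x < U n R s y) : x < y := by
  rcases lt_trichotomy x y with h1 | h1 | h1
  · exact h1
  · subst h1; omega
  · have := star_U n R hG hS s y x h1 hx; omega

lemma rows_pos (n : ℤ) (R : Finset (ℤ × ℤ)) (hR : IsRC n R) (hS : Star n R) :
    ∀ r ∈ R, 1 ≤ r.2 := by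
  rw [isRC_iff] at hR
  obtain ⟨hb, hG⟩ := hR
  intro r hr
  by_contra hc
  obtain ⟨q, hq, hm⟩ := Finset.exists_min_image R (fun r : ℤ × ℤ => toLex (r.2, -r.1)) ⟨r, hr⟩
  have hU : U n R q = 1 := by
    unfold U
    rw [Finset.filter_false_of_mem, wR_empty]
    intro x hx h
    have := hm x hx
    rw [Prod.Lex.toLex_le_toLex] at this
    unfold Aft at h
    simp at this
    omega
  have hr2 := hm r hr
  rw [Prod.Lex.toLex_le_toLex] at hr2
  simp at hr2
  have hbq := hb q hq
  have := (inv_char_w n R hG (q.1 + q.2 - n - 1) (q.1 + q.2 - n) (by omega)).2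
    ⟨q, hq, by simp [lf', hU], by simp [lt', hU]⟩
  have h2 := hS (q.1 + q.2 - n) (by omega)
  omega
lemma U_succ_mem (n : ℤ) (R : Finset (ℤ × ℤ)) (i k : ℤ) (h : (i + 1, k) ∈ R) :
    U n R (i, k) = sT (i + k - n) * U n R (i + 1, k) := by
  unfold U
  have e : R.filter (Aft (i, k)) = insert (i + 1, k) (R.filter (Aft (i + 1, k))) := by
    ext ⟨x, y⟩
    simp only [Finset.mem_filter, Finset.mem_insert, Aft, Prod.mk.injEq]
    constructor
    · rintro ⟨h1, h2⟩
      by_cases h3 : x = i + 1 ∧ y = k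
      · exact Or.inl h3
      · exact Or.inr ⟨h1, by omega⟩
    · rintro (⟨rfl, rfl⟩ | ⟨h1, h2⟩)
      · exact ⟨h, by omega⟩
      · exact ⟨h1, by omega⟩
  rw [e, wR_insert]
  · congr 2; ring
  · intro x hx; exact (Finset.mem_filter.1 hx).2

lemma U_succ_not (n : ℤ) (R : Finset (ℤ × ℤ)) (i k : ℤ) (h : (i + 1, k) ∉ R) :
    U n R (i, k) = U n R (i + 1, k) := by
  unfold U
  congr 1
  apply Finset.filter_congr
  rintro ⟨x, y⟩ hr
  have : ¬ (x = i + 1 ∧ y = k) := by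
    rintro ⟨rfl, rfl⟩; exact h hr
  simp only [Aft]
  omega

lemma lt_succ_mem (n : ℤ) (R : Finset (ℤ × ℤ)) (i k : ℤ) (h : (i + 1, k) ∈ R) :
    lt' n R (i, k) = lt' n R (i + 1, k) := by
  conv_lhs => unfold lt'
  have := U_lt n R (i + 1, k)
  rw [U_succ_mem n R i k h, Equiv.Perm.inv_eq_iff_eq, Equiv.Perm.mul_apply, this, sT_apply]
  simp only
  split_ifs <;> omega

lemma lt_succ_not (n : ℤ) (R : Finset (ℤ × ℤ)) (i k : ℤ) (h : (i + 1, k) ∉ R) :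
    lt' n R (i, k) = lf' n R (i + 1, k) := by
  unfold lt' lf'
  rw [U_succ_not n R i k h]
  congr 1
  simp only
  ring

lemma U_same (n : ℤ) (R : Finset (ℤ × ℤ)) (s s' : ℤ × ℤ) (h : ∀ r, Aft s' r → Aft s r) (z : ℤ)
    (hun : ∀ r ∈ R, Aft s r → ¬ Aft s' r →
      U n R s' z ≠ r.1 + r.2 - n - 1 ∧ U n R s' z ≠ r.1 + r.2 - n) :
    U n R s z = U n R s' z := by
  rw [U_split n R s s' h, Equiv.Perm.mul_apply]
  apply wR_fix
  intro r hr
  obtain ⟨h1, h2, h3⟩ := Finset.mem_filter.1 hr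
  exact hun r h1 h2 h3

lemma lt_n (n : ℤ) (R : Finset (ℤ × ℤ)) (hb : ∀ r ∈ R, r.1 ≤ n) (k : ℤ) :
    lt' n R (n, k) = k := by
  unfold lt'
  rw [show (n, k).1 + (n, k).2 - n = k by simp]
  apply inv_fix
  apply wR_fix
  intro r hr
  obtain ⟨h1, h2⟩ := Finset.mem_filter.1 hr
  have := hb r h1
  unfold Aft at h2
  simp only at h2
  omega

lemma lf_low (n : ℤ) (R : Finset (ℤ × ℤ)) (hb : ∀ r ∈ R, 1 ≤ r.2) (i k : ℤ) (hk : k ≤ 0) :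
    lf' n R (i, k) = i + k - n - 1 := by
  unfold lf'
  apply inv_fix
  apply wR_fix
  intro r hr
  obtain ⟨h1, h2⟩ := Finset.mem_filter.1 hr
  have := hb r h1
  unfold Aft at h2
  simp only at h2
  omega

lemma U_up (n : ℤ) (R : Finset (ℤ × ℤ)) (i k : ℤ) (z : ℤ)
    (hz : U n R (i - 1, k - 1) z = i + k - n - 1) : U n R (i, k) z = i + k - n - 1 := by
  rw [U_same n R (i, k) (i - 1, k - 1), hz]
  · intro r; unfold Aft; simp only; omega
  · rintro ⟨x, y⟩ hr; unfold Aft; simp only; omega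

lemma lf_up_mem (n : ℤ) (R : Finset (ℤ × ℤ)) (i k : ℤ) (h : (i, k - 1) ∈ R) :
    lf' n R (i, k) = lf' n R (i, k - 1) := by
  conv_lhs => unfold lf'
  rw [Equiv.Perm.inv_eq_iff_eq]
  symm
  apply U_up
  rw [U_succ_mem n R (i - 1) (k - 1) (by simpa using h), Equiv.Perm.mul_apply]
  have := U_lf n R (i, k - 1)
  rw [show i - 1 + 1 = i by ring, this, sT_apply]
  simp only
  split_ifs <;> omega

lemma lf_up_not (n : ℤ) (R : Finset (ℤ × ℤ)) (i k : ℤ) (h : (i, k - 1) ∉ R) :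
    lf' n R (i, k) = lt' n R (i, k - 1) := by
  conv_lhs => unfold lf'
  rw [Equiv.Perm.inv_eq_iff_eq]
  symm
  apply U_up
  rw [U_succ_not n R (i - 1) (k - 1) (by simpa using h)]
  have := U_lt n R (i, k - 1)
  rw [show i - 1 + 1 = i by ring, this]
  simp only
  ring

lemma lab_eq_aux (n : ℤ) (R : Finset (ℤ × ℤ)) (hb : ∀ r ∈ R, 1 ≤ r.2 ∧ r.1 ≤ n) (N : ℕ) :
    ∀ i k : ℤ, i ≤ n → (n - i).toNat + k.toNat ≤ N →
      lab n R true i k = lt' n R (i, k) ∧ lab n R false i k = lf' n R (i, k) := by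
  induction N with
  | zero =>
    intro i k hi hN
    obtain rfl : i = n := by omega
    have hk : k ≤ 0 := by omega
    constructor
    · rw [lab, lt_n _ _ (fun r hr => (hb r hr).2)]
      simp
    · rw [lab, lf_low _ _ (fun r hr => (hb r hr).1) _ _ hk]
      simp [hk]
  | succ N ih =>
    intro i k hi hN
    constructor
    · rw [lab]
      split_ifs with h1 h2
      · obtain rfl : i = n := by omega
        rw [lt_n _ _ (fun r hr => (hb r hr).2)]
      · rw [lt_succ_mem _ _ _ _ h2]
        exact (ih (i + 1) k (by omega) (by omega)).1
      · rw [lt_succ_not _ _ _ _ h2]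
        exact (ih (i + 1) k (by omega) (by omega)).2
    · rw [lab]
      split_ifs with h1 h2
      · rw [lf_low _ _ (fun r hr => (hb r hr).1) _ _ h1]
      · rw [lf_up_mem _ _ _ _ h2]
        exact (ih i (k - 1) (by omega) (by omega)).2
      · rw [lf_up_not _ _ _ _ h2]
        exact (ih i (k - 1) (by omega) (by omega)).1

lemma lab_true_eq (n : ℤ) (R : Finset (ℤ × ℤ)) (hb : ∀ r ∈ R, 1 ≤ r.2 ∧ r.1 ≤ n) (p : ℤ × ℤ)
    (hp : p.1 ≤ n) : lab n R true p.1 p.2 = lt' n R p :=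
  (lab_eq_aux n R hb _ p.1 p.2 hp le_rfl).1

lemma lab_false_eq (n : ℤ) (R : Finset (ℤ × ℤ)) (hb : ∀ r ∈ R, 1 ≤ r.2 ∧ r.1 ≤ n) (p : ℤ × ℤ)
    (hp : p.1 ≤ n) : lab n R false p.1 p.2 = lf' n R p :=
  (lab_eq_aux n R hb _ p.1 p.2 hp le_rfl).2

/-- Open spaces in terms of partial products. -/
def Op (n : ℤ) (R : Finset (ℤ × ℤ)) (p : ℤ × ℤ) : Prop :=
  p.1 ≤ n ∧ p ∉ R ∧ lf' n R p ≤ 0 ∧ 0 < lt' n R p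

lemma open_iff (n : ℤ) (R : Finset (ℤ × ℤ)) (hb : ∀ r ∈ R, 1 ≤ r.2 ∧ r.1 ≤ n) (i k : ℤ) :
    OpenSpace n R i k ↔ Op n R (i, k) := by
  unfold OpenSpace Op
  apply and_congr_right
  intro hi
  have h1 := lab_true_eq n R hb (i, k) hi
  have h2 := lab_false_eq n R hb (i, k) hi
  simp only at h1 h2
  rw [h1, h2]

lemma noOp (n : ℤ) (R : Finset (ℤ × ℤ)) (k l z : ℤ) (hl : lt' n R (l, k) ≤ 0) (hz : z ≤ n)
    (h : ∀ x, l < x → x ≤ z → ¬ Op n R (x, k)) : ∀ x, l ≤ x → x ≤ z → lt' n R (x, k) ≤ 0 := by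
  have key : ∀ d : ℕ, l + d ≤ z → lt' n R (l + d, k) ≤ 0 := by
    intro d
    induction d with
    | zero => intro _; simpa using hl
    | succ d ih =>
      intro hd
      push_cast at hd ⊢
      have ih := ih (by omega)
      rw [← add_assoc] at hd ⊢
      by_cases hm : (l + d + 1, k) ∈ R
      · rwa [← lt_succ_mem n R _ k hm]
      · rw [lt_succ_not n R _ k hm] at ih
        by_contra hc
        exact h (l + d + 1) (by omega) hd ⟨by simp; omega, hm, ih, by omega⟩
  intro x h1 h2
  have := key (x - l).toNat (by omega)
  rwa [show l + ((x - l).toNat : ℤ) = x by omega] at this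

/-- Labels after row `k`. -/
def V (n : ℤ) (R : Finset (ℤ × ℤ)) (k : ℤ) : Equiv.Perm ℤ := U n R (n, k + 1)

lemma U_row_eq (n : ℤ) (R : Finset (ℤ × ℤ)) (k x y : ℤ) (hxy : x ≤ y)
    (h : ∀ z, x < z → z ≤ y → (z, k) ∉ R) : U n R (x, k) = U n R (y, k) := by
  unfold U
  congr 1
  apply Finset.filter_congr
  rintro ⟨u, v⟩ hr
  have : v = k → ¬ (x < u ∧ u ≤ y) := by
    rintro rfl ⟨h1, h2⟩; exact h u h1 h2 hr
  simp only [Aft]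
  omega

lemma row_lemma (n : ℤ) (R : Finset (ℤ × ℤ)) (hG : Good n R) (hS : Star n R)
    (hb : ∀ r ∈ R, r.1 ≤ n) (l i k : ℤ) (hli : l < i) (hin : i ≤ n)
    (hl : (l, k) ∉ R) (hl0 : lt' n R (l, k) ≤ 0) (hi : (i, k) ∉ R)
    (hb0 : lf' n R (i, k) ≤ 0)
    (hmin : ∀ x, l < x → x < i → ¬ Op n R (x, k)) :
    V n R k (lt' n R (l, k)) = l + k - n ∧ V n R k (lf' n R (i, k)) = i + k - n - 1 ∧
    ∀ c, 0 < c → l + k - n < V n R k c → i + k - n - 1 < V n R k c := by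
  have s1 : ∀ x, l ≤ x → x ≤ i - 1 → lt' n R (x, k) ≤ 0 :=
    noOp n R k l (i - 1) hl0 (by omega) (fun x h1 h2 => hmin x h1 (by omega))
  have s2 : ∀ x, l < x → x < i → (x, k) ∉ R := by
    intro x h1 h2 hx
    have h3 := hG _ hx
    have h4 := s1 x (by omega) (by omega)
    have h5 := (inv_char_w n R hG _ _ h3).2 ⟨_, hx, rfl, rfl⟩
    have h6 := star_mono n R hS _ _ h3 h4
    omega
  have s3 : ∀ x, l < x → x < i → lf' n R (x, k) ≤ 0 := by
    intro x h1 h2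
    have h3 := s1 (x - 1) (by omega) (by omega)
    rw [lt_succ_not n R (x - 1) k (by simpa using s2 x h1 h2)] at h3
    simpa using h3
  have hmem : ∀ z, l ≤ z → z ≤ i → (z, k) ∉ R := by
    intro z h1 h2
    rcases eq_or_lt_of_le h1 with rfl | h1
    · exact hl
    rcases eq_or_lt_of_le h2 with rfl | h2
    · exact hi
    exact s2 z h1 h2
  have hUx : ∀ x, l ≤ x → x ≤ i → U n R (x, k) = U n R (i, k) := fun x h1 h2 =>
    U_row_eq n R k x i h2 (fun z h3 h4 => hmem z (by omega) h4)
  have hsub : ∀ r, Aft (l, k) r → Aft (n, k + 1) r := by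
    intro r; unfold Aft; simp only; omega
  have hV : ∀ c, l + k - n ≤ U n R (l, k) c → V n R k c = U n R (l, k) c := by
    intro c hc
    apply U_same n R _ _ hsub
    rintro ⟨x, y⟩ hr
    have hxn := hb _ hr
    have : ¬ (x = l ∧ y = k) := by rintro ⟨rfl, rfl⟩; exact hl hr
    simp only [Aft] at *
    omega
  have hV' : ∀ c, l + k - n ≤ V n R k c → V n R k c = U n R (l, k) c := by
    intro c hc
    set d := (U n R (l, k))⁻¹ (V n R k c) with hd
    have h1 : U n R (l, k) d = V n R k c := by simp [hd]
    have h2 := hV d (by omega)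
    rw [h1] at h2
    have : d = c := (V n R k).injective h2
    rw [← this, h2, this]
    rw [this] at h1
    exact h1.symm
  have ht := U_lt n R (l, k)
  have hf := U_lf n R (i, k)
  rw [← hUx l le_rfl (by omega)] at hf
  simp only at ht hf
  refine ⟨?_, ?_, ?_⟩
  · rw [hV _ (by omega), ht]
  · rw [hV _ (by omega), hf]
  · intro c hc h1
    by_contra h2
    have h3 := hV' c (by omega)
    set x := V n R k c - k + n + 1 with hx
    have h4 : lf' n R (x, k) = c := by
      unfold lf'
      rw [Equiv.Perm.inv_eq_iff_eq, hUx x (by omega) (by omega), ← hUx l le_rfl (by omega), ← h3]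
      simp only
      omega
    rcases eq_or_lt_of_le (show x ≤ i by omega) with h5 | h5
    · rw [h5] at h4; omega
    · have := s3 x (by omega) h5
      omega

lemma far_right (n : ℤ) (R : Finset (ℤ × ℤ)) (k M : ℤ) :
    ∃ l, l < M ∧ (l, k) ∉ R ∧ lt' n R (l, k) ≤ 0 ∧ (∀ x ≤ l, ¬ Op n R (x, k)) ∧
      ∀ c, 0 < c → l + k - n < V n R k c := by
  have : ∃ L, ∀ r ∈ R, L ≤ r.1 ∧ L ≤ r.1 + r.2 := by
    induction R using Finset.induction_on with
    | empty => exact ⟨0, by simp⟩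
    | insert a s ha ih =>
      obtain ⟨L, hL⟩ := ih
      refine ⟨min L (min a.1 (a.1 + a.2)), ?_⟩
      intro r hr
      rcases Finset.mem_insert.1 hr with rfl | hr
      · omega
      · have := hL r hr; omega
  obtain ⟨L, hL⟩ := this
  have hfix : ∀ s y, y < L - n - 1 → U n R s y = y := by
    intro s y hy
    apply wR_fix
    intro r hr
    have := hL r (Finset.mem_filter.1 hr).1
    omega
  have hlt : ∀ x, x + k < L - 1 → lt' n R (x, k) = x + k - n := by
    intro x hx
    unfold lt'
    apply inv_fix
    apply hfix
    simp only
    omega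
  refine ⟨min (M - 1) (min (L - 1) (min (L - k - 2) (n - k))), by omega, ?_, ?_, ?_, ?_⟩
  · intro h
    have := hL _ h
    simp only at this
    omega
  · rw [hlt _ (by omega)]; omega
  · rintro x hx ⟨h1, h2, h3, h4⟩
    rw [hlt _ (by omega)] at h4
    omega
  · intro c hc
    by_contra hcon
    have h1 := hfix (n, k + 1) (V n R k c) (by omega)
    have : V n R k c = c := (U n R (n, k + 1)).injective h1
    omega
lemma lt_ins_after (n : ℤ) (R : Finset (ℤ × ℤ)) (p r : ℤ × ℤ) (hp : p ∉ R) (h : Aft r p) :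
    lt' n (insert p R) r = Equiv.swap (lt' n R p) (lf' n R p) (lt' n R r) := by
  rw [lt', U_insert n R p r hp h]
  simp [lt', mul_inv_rev]

lemma lf_ins_after (n : ℤ) (R : Finset (ℤ × ℤ)) (p r : ℤ × ℤ) (hp : p ∉ R) (h : Aft r p) :
    lf' n (insert p R) r = Equiv.swap (lt' n R p) (lf' n R p) (lf' n R r) := by
  rw [lf', U_insert n R p r hp h]
  simp [lf', mul_inv_rev]

lemma lt_ins_before (n : ℤ) (R : Finset (ℤ × ℤ)) (p r : ℤ × ℤ) (h : ¬ Aft r p) :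
    lt' n (insert p R) r = lt' n R r := by
  rw [lt', U_insert_not n R p r h, lt']

lemma lf_ins_before (n : ℤ) (R : Finset (ℤ × ℤ)) (p r : ℤ × ℤ) (h : ¬ Aft r p) :
    lf' n (insert p R) r = lf' n R r := by
  rw [lf', U_insert_not n R p r h, lf']

lemma not_lt_swap {u : Equiv.Perm ℤ} {x y : ℤ} (h : x ≠ y) : u x < u y ∨ u y < u x := by
  have : u x ≠ u y := fun e => h (u.injective e)
  omega

lemma no_inv_at (n : ℤ) (R : Finset (ℤ × ℤ)) (p : ℤ × ℤ) :
    U n R p (lf' n R p) < U n R p (lt' n R p) := by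
  rw [U_lf, U_lt]; omega

/-- a crossing of the two strands meeting at the open space `p` comes later -/
lemma cross_later (n : ℤ) (R : Finset (ℤ × ℤ)) (hG : Good n R) (p q : ℤ × ℤ)
    (hp : Op n R p) (hq : q ∈ R)
    (h1 : lf' n R q = lf' n R p) (h2 : lt' n R q = lt' n R p) : Aft q p := by
  have hne : p ≠ q := by rintro rfl; exact hp.2.1 hq
  rcases Aft.tri hne with h | h
  · have := (inv_char n R hG p (lf' n R p) (lt' n R p) (by have := hp.2.2; omega)).2
      ⟨q, hq, h, h1, h2⟩
    have := no_inv_at n R p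
    omega
  · exact h

lemma cross_row (n : ℤ) (R : Finset (ℤ × ℤ)) (hG : Good n R) (p q : ℤ × ℤ)
    (hp : Op n R p) (hq : q ∈ R)
    (h1 : lf' n R q = lf' n R p) (h2 : lt' n R q = lt' n R p) : p.2 < q.2 := by
  have hA := cross_later n R hG p q hp hq h1 h2
  by_contra hc
  have hs := U_same n R q p (fun r hr => hA.trans hr) (lt' n R p) (by
    intro r hr h3 h4
    rw [U_lt]
    have hne : ¬ (r.1 = p.1 ∧ r.2 = p.2) := by
      rintro ⟨e1, e2⟩
      exact hp.2.1 ((Prod.ext e1 e2 : r = p) ▸ hr)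
    unfold Aft at *
    omega)
  rw [U_lt, ← h2, U_lt] at hs
  unfold Aft at hA
  omega

lemma cross_exists (n : ℤ) (R : Finset (ℤ × ℤ)) (hG : Good n R) (p : ℤ × ℤ)
    (hp : Op n R p) (hbad : ¬ Good n (insert p R)) :
    ∃ q ∈ R, lf' n R q = lf' n R p ∧ lt' n R q = lt' n R p := by
  obtain ⟨hp1, hp2, hp3, hp4⟩ := hp
  set a := lt' n R p with ha
  set b := lf' n R p with hb
  have hba : b < a := by omega
  rw [← inv_char_w n R hG b a hba]
  by_contra hw
  have hwba : wR n R b < wR n R a := by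
    have := not_lt_swap (u := wR n R) (show b ≠ a by omega); omega
  apply hbad
  intro r hr
  by_cases hA : Aft r p
  swap
  · rw [lt_ins_before n R p r hA, lf_ins_before n R p r hA]
    rcases Finset.mem_insert.1 hr with rfl | hr
    · exact hba
    · exact hG r hr
  have hrR : r ∈ R := by
    rcases Finset.mem_insert.1 hr with rfl | hr
    · exact absurd hA (Aft.irrefl _)
    · exact hr
  rw [lt_ins_after n R p r hp2 hA, lf_ins_after n R p r hp2 hA, ← ha, ← hb]
  have hxy := hG r hrR
  have hUr := no_inv_at n R r
  have hwr := (inv_char_w n R hG _ _ hxy).2 ⟨r, hrR, rfl, rfl⟩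
  set x := lf' n R r with hx
  set y := lt' n R r with hy
  have hUxy : U n R p x < U n R p y := by
    by_contra hc
    have h1 := not_lt_swap (u := U n R p) (show x ≠ y by omega)
    have := inv_mono n R hG r p (fun t ht => hA.trans ht) x y hxy (by omega)
    omega
  have hUa : U n R p a = p.1 + p.2 - n := U_lt n R p
  have hUb : U n R p b = p.1 + p.2 - n - 1 := U_lf n R p
  have keep : ∀ u v, u < v → wR n R u < wR n R v → U n R p u < U n R p v := by
    intro u v huv hw'
    by_contra hc
    have h1 := not_lt_swap (u := U n R p) (show u ≠ v by omega)
    have := inv_mono_w n R hG p u v huv (by omega)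
    omega
  rw [Equiv.swap_apply_def, Equiv.swap_apply_def]
  by_cases c1 : x = b
  · by_cases c2 : y = a
    · rw [c1, c2] at hwr; omega
    · by_cases c3 : y < a
      · rw [c1] at hwr hUxy
        have := keep y a c3 (by omega)
        omega
      · split_ifs <;> omega
  · by_cases c2 : y = a
    · by_cases c3 : b < x
      · rw [c2] at hwr hUxy
        have := keep b x c3 (by omega)
        omega
      · split_ifs <;> omega
    · split_ifs <;> omega

lemma isRC_cols {n : ℤ} {R : Finset (ℤ × ℤ)} (h : IsRC n R) : ∀ r ∈ R, r.1 ≤ n :=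
  fun r hr => (h.1 r hr).1

lemma V_ins_low (n : ℤ) (R : Finset (ℤ × ℤ)) (p : ℤ × ℤ) (hp : p.1 ≤ n) (j : ℤ) (hj : j < p.2) :
    V n (insert p R) j = V n R j := by
  apply U_insert_not
  unfold Aft; simp only; omega

lemma V_ins (n : ℤ) (R : Finset (ℤ × ℤ)) (p : ℤ × ℤ) (hp : p ∉ R) (j : ℤ) (hj : p.2 ≤ j) :
    V n (insert p R) j = V n R j * Equiv.swap (lt' n R p) (lf' n R p) := by
  apply U_insert n R p _ hp
  unfold Aft; simp only; omega

lemma wR_eq_V (n : ℤ) (R : Finset (ℤ × ℤ)) (h : ∀ r ∈ R, r.1 ≤ n ∧ r.2 ≤ n) :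
    wR n R = V n R n := by
  unfold V U
  congr 1
  symm
  apply Finset.filter_true_of_mem
  intro r hr
  have := h r hr
  unfold Aft; simp only; omega

/-- Data of a complete insertion starting in row `k`. -/
structure Tr (n : ℤ) (R S : Finset (ℤ × ℤ)) (k : ℤ) (a b : ℤ → ℤ) : Prop where
  rc : IsRC n S
  st : Star n S
  card : S.card = R.card + 1
  pos : ∀ j, k ≤ j → 0 < a j ∧ b j ≤ 0
  mul : ∀ j, k ≤ j → V n S j = V n R j * Equiv.swap (a j) (b j)
  lt : ∀ j, k ≤ j → V n R j (b j) < V n R j (a j)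
  mono : ∀ j, k ≤ j → b j ≤ b (j + 1)
  next : ∀ j, k ≤ j → ∀ c, 0 < c → V n R (j + 1) (b j) < V n R (j + 1) c →
    V n R (j + 1) (b (j + 1)) < V n R (j + 1) c
  low : ∀ j, j < k → V n S j = V n R j

lemma tr_final (n : ℤ) (R : Finset (ℤ × ℤ)) (hR : IsRC n R) (hS : Star n R) (p : ℤ × ℤ)
    (hp : Op n R p) (hpn : p.2 ≤ n) (hg : IsRC n (insert p R)) :
    Tr n R (insert p R) p.2 (fun _ => lt' n R p) (fun _ => lf' n R p) := by
  have hG := ((isRC_iff n R).1 hR).2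
  have hG' := ((isRC_iff n _).1 hg).2
  have hba : lf' n R p < lt' n R p := by have := hp.2.2; omega
  have hlt : ∀ j, p.2 ≤ j → V n R j (lf' n R p) < V n R j (lt' n R p) := by
    intro j hj
    by_contra hc
    have h1 := not_lt_swap (u := V n R j) (show lf' n R p ≠ lt' n R p by omega)
    obtain ⟨r, h2, h3, h4, h5⟩ := (inv_char n R hG (n, j + 1) _ _ hba).1
      (h1.resolve_left hc)
    have hA := cross_later n R hG p r hp h2 h4 h5
    have := hG' r (by simp [h2])
    rw [lt_ins_after n R p r hp.2.1 hA, lf_ins_after n R p r hp.2.1 hA, h4, h5] at this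
    simp at this
    omega
  refine ⟨hg, ?_, ?_, fun j _ => ⟨hp.2.2.2, hp.2.2.1⟩, fun j hj => V_ins n R p hp.2.1 j hj,
    hlt, fun j _ => le_rfl, fun j _ c _ h => h, fun j hj => V_ins_low n R p hp.1 j hj⟩
  · have hw : wR n (insert p R) = wR n R * Equiv.swap (lt' n R p) (lf' n R p) := by
      rw [wR_eq_V n _ hg.1, wR_eq_V n _ hR.1, V_ins n R p hp.2.1 n hpn]
    have hwlt := hlt n hpn
    rw [← wR_eq_V n R hR.1] at hwlt
    obtain ⟨hp1, hp2, hp3, hp4⟩ := hp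
    intro i hi
    rw [hw, Equiv.Perm.mul_apply, Equiv.Perm.mul_apply, Equiv.swap_apply_def,
      Equiv.swap_apply_def]
    have h0 := hS i hi
    have hUa : U n R p (lt' n R p) = p.1 + p.2 - n := U_lt n R p
    have hUb : U n R p (lf' n R p) = p.1 + p.2 - n - 1 := U_lf n R p
    set a := lt' n R p
    set b := lf' n R p
    rw [if_neg (show ¬ (i - 1 = a) by omega), if_neg (show ¬ (i = a) by omega)]
    by_cases c1 : i - 1 = b
    · rw [if_pos c1, if_neg (by omega)]
      have h1 := star_U n R hG hS p b i (by omega) hi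
      have h2 := not_lt_swap (u := U n R p) (show i ≠ a by omega)
      exact inv_mono_w n R hG p i a (by omega) (by omega)
    · rw [if_neg c1]
      by_cases c2 : i = b
      · rw [if_pos c2]; rw [c2] at h0 ⊢; omega
      · rw [if_neg c2]; exact h0
  · exact Finset.card_insert_of_notMem hp.2.1
/-- Properties of the diagram after exchanging the later crossing `q` for `p`. -/
lemma exch (n : ℤ) (R : Finset (ℤ × ℤ)) (hR : IsRC n R) (hS : Star n R) (p q : ℤ × ℤ)
    (hp : Op n R p) (hpn : p.2 ≤ n) (hq : q ∈ R)
    (h1 : lf' n R q = lf' n R p) (h2 : lt' n R q = lt' n R p) :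
    (∀ j, j < p.2 → V n ((insert p R).erase q) j = V n R j) ∧
    (∀ j, p.2 ≤ j → j < q.2 → V n ((insert p R).erase q) j =
      V n R j * Equiv.swap (lt' n R p) (lf' n R p)) ∧
    (∀ j, q.2 ≤ j → V n ((insert p R).erase q) j = V n R j) ∧
    IsRC n ((insert p R).erase q) ∧ Star n ((insert p R).erase q) ∧
    ((insert p R).erase q).card = R.card ∧
    lt' n ((insert p R).erase q) q = lf' n R p ∧ lf' n ((insert p R).erase q) q = lt' n R p := by
  have hG := ((isRC_iff n R).1 hR).2
  have hA := cross_later n R hG p q hp hq h1 h2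
  have hrow := cross_row n R hG p q hp hq h1 h2
  have hqI : q ∈ insert p R := by simp [hq]
  have hXins : insert q ((insert p R).erase q) = insert p R := Finset.insert_erase hqI
  have hqX : q ∉ (insert p R).erase q := by simp
  have hqn := hR.1 q hq
  set X := (insert p R).erase q with hX
  have e1 : lt' n X q = lf' n R p := by
    rw [← lt_ins_before n X q q (Aft.irrefl q), hXins, lt_ins_after n R p q hp.2.1 hA, h2]
    simp
  have e2 : lf' n X q = lt' n R p := by
    rw [← lf_ins_before n X q q (Aft.irrefl q), hXins, lf_ins_after n R p q hp.2.1 hA, h1]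
    simp
  have v1 : ∀ j, j < p.2 → V n X j = V n R j := by
    intro j hj
    rw [← V_ins_low n X q hqn.1 j (by omega), hXins, V_ins_low n R p hp.1 j hj]
  have v2 : ∀ j, p.2 ≤ j → j < q.2 → V n X j =
      V n R j * Equiv.swap (lt' n R p) (lf' n R p) := by
    intro j hj hj'
    rw [← V_ins_low n X q hqn.1 j (by omega), hXins, V_ins n R p hp.2.1 j hj]
  have v3 : ∀ j, q.2 ≤ j → V n X j = V n R j := by
    intro j hj
    have h3 := V_ins n X q hqX j hj
    rw [hXins, V_ins n R p hp.2.1 j (by omega), e1, e2, Equiv.swap_comm] at h3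
    exact (mul_right_cancel h3).symm
  have hbd : ∀ r ∈ X, r.1 ≤ n ∧ r.2 ≤ n := by
    intro r hr
    have := Finset.mem_of_mem_erase hr
    rcases Finset.mem_insert.1 this with rfl | h
    · exact ⟨hp.1, hpn⟩
    · exact hR.1 r h
  have hw : wR n X = wR n R := by
    rw [wR_eq_V n X hbd, wR_eq_V n R hR.1, v3 n hqn.2]
  have hcard : X.card = R.card := by
    rw [hX, Finset.card_erase_of_mem hqI, Finset.card_insert_of_notMem hp.2.1]
    simp
  refine ⟨v1, v2, v3, ⟨hbd, ?_⟩, ?_, hcard, e1, e2⟩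
  · rw [hw, hcard]; exact hR.2
  · unfold Star; rw [hw]; exact hS

lemma headI_mem {C : Finset (ℤ × ℤ)} (h : C.Nonempty) : (C.sort rcOrder).headI ∈ C := by
  have h1 : C.sort rcOrder ≠ [] := by
    intro h2
    obtain ⟨x, hx⟩ := h
    rw [← Finset.mem_sort rcOrder, h2] at hx
    simp at hx
  rw [← Finset.mem_sort rcOrder]
  cases h3 : C.sort rcOrder with
  | nil => exact absurd h3 h1
  | cons x l => simp

lemma exists_open (n : ℤ) (R : Finset (ℤ × ℤ)) (hb : ∀ r ∈ R, r.1 ≤ n) (l k : ℤ) (hk : 1 ≤ k)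
    (hl : l ≤ n) (hl0 : lt' n R (l, k) ≤ 0) : ∃ x, l < x ∧ Op n R (x, k) := by
  by_contra hc
  push Not at hc
  have := noOp n R k l n hl0 le_rfl (fun x h1 _ => hc x h1) n hl le_rfl
  rw [lt_n n R hb] at this
  omega

lemma sInf_spec (A : Set ℤ) (hne : A.Nonempty) (l : ℤ) (hl : ∀ x ∈ A, l ≤ x) :
    sInf A ∈ A ∧ ∀ x < sInf A, x ∉ A := by
  have hb : BddBelow A := ⟨l, fun x hx => hl x hx⟩
  refine ⟨Int.csInf_mem hne hb, ?_⟩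
  intro x hx h
  have := csInf_le hb h
  omega

lemma loop (n : ℤ) (fuel : ℕ) : ∀ (R : Finset (ℤ × ℤ)) (p : ℤ × ℤ), IsRC n R → Star n R →
    Op n R p → 1 ≤ p.2 → p.2 ≤ n → (n + 1 - p.2).toNat ≤ fuel →
    ∃ S q a b, (insertSteps n fuel (insert p R) p).getLast? = some (S, q) ∧
      Tr n R S p.2 a b ∧ b p.2 = lf' n R p := by
  induction fuel with
  | zero =>
    intro R p _ _ _ _ h1 h2
    omega
  | succ fuel ih =>
    intro R p hR hS hp hp1 hpn hfuel
    by_cases hg : IsRC n (insert p R)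
    · refine ⟨insert p R, p, _, _, ?_, tr_final n R hR hS p hp hpn hg, rfl⟩
      simp [insertSteps, hg]
    have hG := ((isRC_iff n R).1 hR).2
    have hbdc : ∀ r ∈ insert p R, r.1 ≤ n ∧ r.2 ≤ n := by
      intro r hr
      rcases Finset.mem_insert.1 hr with rfl | h
      · exact ⟨hp.1, hpn⟩
      · exact hR.1 r h
    have hposc : ∀ r ∈ insert p R, 1 ≤ r.2 ∧ r.1 ≤ n := by
      intro r hr
      rcases Finset.mem_insert.1 hr with rfl | h
      · exact ⟨hp1, hp.1⟩
      · exact ⟨rows_pos n R hR hS r h, (hR.1 r h).1⟩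
    have hbad : ¬ Good n (insert p R) := fun h => hg ((isRC_iff n _).2 ⟨hbdc, h⟩)
    have hltp : lt' n (insert p R) p = lt' n R p := lt_ins_before n R p p (Aft.irrefl p)
    have hlfp : lf' n (insert p R) p = lf' n R p := lf_ins_before n R p p (Aft.irrefl p)
    have hba : lf' n R p < lt' n R p := by have := hp.2.2; omega
    rw [insertSteps, if_neg hg]
    simp only
    rw [lab_true_eq n _ hposc p hp.1, lab_false_eq n _ hposc p hp.1, hltp, hlfp]
    set C := (insert p R).filter fun q =>
      q ≠ p ∧ ((lab n (insert p R) true q.1 q.2 = lt' n R p ∧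
          lab n (insert p R) false q.1 q.2 = lf' n R p) ∨
        (lab n (insert p R) true q.1 q.2 = lf' n R p ∧
          lab n (insert p R) false q.1 q.2 = lt' n R p)) with hC
    have hCne : C.Nonempty := by
      obtain ⟨q, hq, h1, h2⟩ := cross_exists n R hG p hp hbad
      have hA := cross_later n R hG p q hp hq h1 h2
      refine ⟨q, ?_⟩
      rw [hC, Finset.mem_filter]
      have hqI : q ∈ insert p R := by simp [hq]
      refine ⟨hqI, ?_, Or.inr ?_⟩
      · rintro rfl; exact Aft.irrefl _ hA
      · rw [lab_true_eq n _ hposc q (hposc q hqI).2, lab_false_eq n _ hposc q (hposc q hqI).2,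
          lt_ins_after n R p q hp.2.1 hA, lf_ins_after n R p q hp.2.1 hA, h1, h2]
        simp
    have hqC := headI_mem hCne
    set q := (C.sort rcOrder).headI with hqdef
    clear_value q
    rw [hC, Finset.mem_filter] at hqC
    obtain ⟨hqI, hqp, hql⟩ := hqC
    have hq : q ∈ R := (Finset.mem_insert.1 hqI).resolve_left hqp
    rw [lab_true_eq n _ hposc q (hposc q hqI).2, lab_false_eq n _ hposc q (hposc q hqI).2] at hql
    have hlab : lf' n R q = lf' n R p ∧ lt' n R q = lt' n R p := by
      have hgq := hG q hq
      by_cases hA : Aft q p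
      · rw [lt_ins_after n R p q hp.2.1 hA, lf_ins_after n R p q hp.2.1 hA,
          Equiv.swap_apply_def, Equiv.swap_apply_def] at hql
        split_ifs at hql <;> omega
      · rw [lt_ins_before n R p q hA, lf_ins_before n R p q hA] at hql
        omega
    obtain ⟨h1, h2⟩ := hlab
    have hrow := cross_row n R hG p q hp hq h1 h2
    obtain ⟨v1, v2, v3, hXrc, hXst, hXcard, e1, e2⟩ := exch n R hR hS p q hp hpn hq h1 h2
    have hqX : q ∉ (insert p R).erase q := by simp
    have hqn := hR.1 q hq
    set X := (insert p R).erase q with hX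
    clear_value X
    have hXpos : ∀ r ∈ X, 1 ≤ r.2 ∧ r.1 ≤ n := fun r hr =>
      ⟨rows_pos n X hXrc hXst r hr, (hXrc.1 r hr).1⟩
    have hXG := ((isRC_iff n X).1 hXrc).2
    have hset : {x : ℤ | q.1 < x ∧ OpenSpace n X x q.2} =
        {x : ℤ | q.1 < x ∧ Op n X (x, q.2)} := by
      ext x
      simp only [Set.mem_ofPred_eq]
      rw [open_iff n X hXpos]
    rw [hset]
    have hex : {x : ℤ | q.1 < x ∧ Op n X (x, q.2)}.Nonempty := by
      obtain ⟨x, hx⟩ := exists_open n X (fun r hr => (hXpos r hr).2) q.1 q.2 (by omega) hqn.1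
        (by rw [Prod.mk.eta, e1]; exact hp.2.2.1)
      exact ⟨x, hx⟩
    obtain ⟨hi1, hi2⟩ := sInf_spec _ hex q.1 (fun x hx => le_of_lt hx.1)
    set i' := sInf {x : ℤ | q.1 < x ∧ Op n X (x, q.2)} with hi'
    clear_value i'
    obtain ⟨hqi, hop⟩ := hi1
    obtain ⟨S, z, a', b', hlast, hT, hb'⟩ := ih X (i', q.2) hXrc hXst hop (by simp only; omega)
      (by simp only; omega) (by simp only; omega)
    simp only at hT hb'
    have hrl := row_lemma n X hXG hXst (fun r hr => (hXpos r hr).2) q.1 i' q.2 hqi hop.1 hqX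
      (by rw [Prod.mk.eta, e1]; exact hp.2.2.1) hop.2.1 hop.2.2.1
      (fun x h3 h4 h5 => hi2 x h4 ⟨h3, h5⟩)
    rw [Prod.mk.eta, e1] at hrl
    obtain ⟨r1, r2, r3⟩ := hrl
    refine ⟨S, z, fun j => if j < q.2 then lt' n R p else a' j,
      fun j => if j < q.2 then lf' n R p else b' j, ?_, ?_, ?_⟩
    · rw [List.getLast?_cons, hlast]; rfl
    · refine ⟨hT.rc, hT.st, by rw [hT.card, hXcard], ?_, ?_, ?_, ?_, ?_, ?_⟩
      · intro j hj
        by_cases hc : j < q.2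
        · simp only [if_pos hc]; exact ⟨hp.2.2.2, hp.2.2.1⟩
        · simp only [if_neg hc]; exact hT.pos j (by omega)
      · intro j hj
        by_cases hc : j < q.2
        · simp only [if_pos hc]; rw [hT.low j hc, v2 j hj hc]
        · simp only [if_neg hc]; rw [hT.mul j (by omega), v3 j (by omega)]
      · intro j hj
        by_cases hc : j < q.2
        · simp only [if_pos hc]
          by_contra hcon
          have h3 := not_lt_swap (u := V n R j) (show lf' n R p ≠ lt' n R p by omega)
          obtain ⟨r, h4, h5, h6, h7⟩ := (inv_char n R hG (n, j + 1) _ _ hba).1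
            (h3.resolve_left hcon)
          have hrn := hR.1 r h4
          have hqr : Aft q r := by unfold Aft at *; simp only at h5; omega
          have h8 := (inv_char n R hG q _ _ hba).2 ⟨r, h4, hqr, h6, h7⟩
          have h9 := no_inv_at n R q
          rw [h1, h2] at h9
          omega
        · simp only [if_neg hc]; rw [← v3 j (by omega)]; exact hT.lt j (by omega)
      · intro j hj
        by_cases hc : j + 1 < q.2
        · simp only [if_pos hc, if_pos (show j < q.2 by omega)]; exact le_rfl
        · by_cases hc' : j < q.2
          · have hjq : j + 1 = q.2 := by omega
            simp only [if_neg hc, if_pos hc']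
            rw [hjq, hb']
            by_contra hcon
            have := star_U n X hXG hXst (n, q.2 + 1) (lf' n X (i', q.2)) (lf' n R p) (by omega)
              hp.2.2.1
            unfold V at r1 r2
            omega
          · simp only [if_neg hc, if_neg hc']; exact hT.mono j (by omega)
      · intro j hj c hc0
        by_cases hc : j + 1 < q.2
        · simp only [if_pos hc, if_pos (show j < q.2 by omega)]; exact id
        · by_cases hc' : j < q.2
          · have hjq : j + 1 = q.2 := by omega
            simp only [if_neg hc, if_pos hc']
            rw [hjq, hb', ← v3 q.2 le_rfl, r1, r2]
            exact r3 c hc0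
          · simp only [if_neg hc, if_neg hc']
            rw [← v3 (j + 1) (by omega)]
            exact hT.next j (by omega) c hc0
      · intro j hj
        rw [hT.low j (by omega), v1 j hj]
    · simp only [if_pos hrow]

lemma insertOne_spec (n : ℤ) (R : Finset (ℤ × ℤ)) (hR : IsRC n R) (hS : Star n R) (k : ℤ)
    (hk : 1 ≤ k) (hkn : k ≤ n) : ∃ a b : ℤ → ℤ, Tr n R (insertOne n R k) k a b ∧
      ∀ c, 0 < c → V n R k (b k) < V n R k c := by
  have hpos : ∀ r ∈ R, 1 ≤ r.2 ∧ r.1 ≤ n := fun r hr =>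
    ⟨rows_pos n R hR hS r hr, (hR.1 r hr).1⟩
  have hG := ((isRC_iff n R).1 hR).2
  obtain ⟨l, hl1, hl2, hl3, hl4, hl5⟩ := far_right n R k n
  have hset : {x : ℤ | OpenSpace n R x k} = {x : ℤ | Op n R (x, k)} := by
    ext x
    simp only [Set.mem_ofPred_eq]
    rw [open_iff n R hpos]
  have hex : {x : ℤ | Op n R (x, k)}.Nonempty := by
    obtain ⟨x, hx⟩ := exists_open n R (fun r hr => (hpos r hr).2) l k hk (by omega) hl3
    exact ⟨x, hx.2⟩
  have hlx : ∀ x, Op n R (x, k) → l < x := by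
    intro x hx
    by_contra hc
    exact hl4 x (by omega) hx
  obtain ⟨hi1, hi2⟩ := sInf_spec _ hex l (fun x hx => le_of_lt (hlx x hx))
  obtain ⟨S, z, a, b, hlast, hT, hb⟩ := loop n ((n + 1 - k).toNat + 1) R
    (sInf {x : ℤ | Op n R (x, k)}, k) hR hS hi1 hk hkn (by simp only; omega)
  have hins : insertOne n R k = S := by
    unfold insertOne insertStepsOf
    simp only
    rw [hset, hlast]
    rfl
  rw [hins]
  refine ⟨a, b, hT, ?_⟩
  simp only at hb
  rw [hb]
  obtain ⟨r1, r2, r3⟩ := row_lemma n R hG hS (fun r hr => (hpos r hr).2) l _ k (hlx _ hi1) hi1.1 hl2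
    hl3 hi1.2.1 hi1.2.2.1 (fun x _ h h' => hi2 x h h')
  intro c hc
  rw [r2]
  exact r3 c hc (hl5 c hc)

lemma two_insert (n : ℤ) (R S T : Finset (ℤ × ℤ)) (k k' : ℤ) (hkk : k ≤ k')
    (hR : IsRC n R) (hS : Star n R) (a b a' b' : ℤ → ℤ)
    (h : Tr n R S k a b) (h' : Tr n S T k' a' b')
    (hst : ∀ c, 0 < c → V n S k' (b' k') < V n S k' c) :
    ∀ j, k' ≤ j → b' j < b j := by
  have hG := ((isRC_iff n R).1 hR).2
  have hGS := ((isRC_iff n S).1 h.rc).2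
  have hsw : ∀ j, k ≤ j → V n S j (a j) = V n R j (b j) ∧ V n S j (b j) = V n R j (a j) := by
    intro j hj
    rw [h.mul j hj]
    simp
  intro j hj
  induction j, hj using Int.le_induction with
  | base =>
    have h1 := hst (a k') (h.pos k' hkk).1
    have h2 := hsw k' hkk
    have h3 := h.lt k' hkk
    exact star_U_lt n S hGS h.st (n, k' + 1) _ _ (h'.pos k' le_rfl).2 (h.pos k' hkk).2
      (show V n S k' _ < V n S k' _ by omega)
  | succ j hj ih =>
    have hm := h.mono j (by omega)
    have hp := h.pos (j + 1) (by omega)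
    have hp' := h'.pos j hj
    have hp'' := h'.pos (j + 1) (by omega)
    have h2 := hsw (j + 1) (by omega)
    have h3 := h.lt (j + 1) (by omega)
    have hfix : V n S (j + 1) (b' j) = V n R (j + 1) (b' j) := by
      rw [h.mul (j + 1) (by omega), Equiv.Perm.mul_apply,
        Equiv.swap_apply_of_ne_of_ne (by omega) (by omega)]
    have h4 : V n R (j + 1) (b' j) < V n R (j + 1) (b (j + 1)) :=
      star_U n R hG hS _ _ _ (by omega) hp.2
    have h5 := h'.next j hj (a (j + 1)) hp.1 (by omega)
    exact star_U_lt n S hGS h.st (n, j + 1 + 1) _ _ hp''.2 hp.2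
      (show V n S (j + 1) _ < V n S (j + 1) _ by omega)

lemma insertWord_eq (n : ℤ) (R : Finset (ℤ × ℤ)) (v : List ℕ) :
    insertWord n R v = (v.map (fun a : ℕ => (a : ℤ))).foldl (fun S a => insertOne n S a) R := by
  rw [List.map_eq_flatMap]
  simp [insertWord]

lemma foldl_range (n : ℤ) (R : Finset (ℤ × ℤ)) (a : ℕ → ℕ) (m : ℕ) :
    insertWord n R ((List.range (m + 1)).map fun t => a (t + 1)) =
      insertOne n (insertWord n R ((List.range m).map fun t => a (t + 1))) (a (m + 1)) := by
  rw [insertWord_eq, insertWord_eq, List.range_succ, List.map_append, List.map_append,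
    List.foldl_append]
  rfl

/-- Inserting a weakly increasing sequence `a₁ ≤ … ≤ a_m` into an
rc-graph `R` satisfying (*) multiplies `w_R` by a chain of transpositions `s_{cᵢ,dᵢ}`
with `cᵢ > 0 ≥ dᵢ`, `d₁ > d₂ > … > d_m`, each partial product increasing the length
by one. -/
theorem insert_increasing_sequence (n : ℕ) (hn : 0 < n) (R : Finset (ℤ × ℤ))
    (hR : IsRC n R) (hS : Star n R) (m : ℕ) (a : ℕ → ℕ)
    (ha : ∀ i, 1 ≤ i → i ≤ m → 1 ≤ a i ∧ a i ≤ n)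
    (hmono : ∀ i, 1 ≤ i → i < m → a i ≤ a (i + 1)) :
    ∃ c d : ℕ → ℤ,
      (∀ i, 1 ≤ i → i ≤ m → 0 < c i ∧ d i ≤ 0) ∧
      (∀ i, 1 ≤ i → i < m → d (i + 1) < d i) ∧
      (∀ m' ≤ m,
        len (wR n R *
          ((List.range m').map fun t => Equiv.swap (c (t + 1)) (d (t + 1))).prod)
          = len (wR n R) + m') ∧
      wR n (insertWord n R ((List.range m).map fun t => a (t + 1)))
        = wR n R * ((List.range m).map fun t => Equiv.swap (c (t + 1)) (d (t + 1))).prod := by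
  set S : ℕ → Finset (ℤ × ℤ) := fun t => insertWord n R ((List.range t).map fun t => a (t + 1))
    with hSdef
  have S0 : S 0 = R := by simp [hSdef, insertWord_eq]
  have Ssucc : ∀ t, S (t + 1) = insertOne n (S t) (a (t + 1)) := fun t => foldl_range n R a t
  have hrange : ∀ t, t < m → (1 : ℤ) ≤ (a (t + 1) : ℤ) ∧ (a (t + 1) : ℤ) ≤ (n : ℤ) := by
    intro t ht
    have := ha (t + 1) (by omega) (by omega)
    omega
  have step : ∀ t, t < m → IsRC n (S t) → Star n (S t) → ∃ A B : ℤ → ℤ,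
      Tr n (S t) (S (t + 1)) (a (t + 1)) A B ∧
        ∀ c, 0 < c → V n (S t) (a (t + 1)) (B (a (t + 1))) < V n (S t) (a (t + 1)) c := by
    intro t ht h1 h2
    rw [Ssucc t]
    exact insertOne_spec n (S t) h1 h2 _ (hrange t ht).1 (hrange t ht).2
  have good : ∀ t, t ≤ m → IsRC n (S t) ∧ Star n (S t) ∧ (S t).card = R.card + t := by
    intro t
    induction t with
    | zero => intro _; rw [S0]; exact ⟨hR, hS, rfl⟩
    | succ t ih =>
      intro ht
      obtain ⟨h1, h2, h3⟩ := ih (by omega)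
      obtain ⟨A, B, hT, -⟩ := step t (by omega) h1 h2
      exact ⟨hT.rc, hT.st, by rw [hT.card, h3]; omega⟩
  have ex : ∀ t, ∃ A B : ℤ → ℤ, t < m →
      Tr n (S t) (S (t + 1)) (a (t + 1)) A B ∧
        ∀ c, 0 < c → V n (S t) (a (t + 1)) (B (a (t + 1))) < V n (S t) (a (t + 1)) c := by
    intro t
    by_cases ht : t < m
    · obtain ⟨A, B, h⟩ := step t ht (good t ht.le).1 (good t ht.le).2.1
      exact ⟨A, B, fun _ => h⟩
    · exact ⟨id, id, fun h => absurd h ht⟩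
  choose A B hAB using ex
  have prodEq : ∀ t, t ≤ m → wR n (S t) = wR n R *
      ((List.range t).map fun t => Equiv.swap (A (t + 1 - 1) n) (B (t + 1 - 1) n)).prod := by
    intro t
    induction t with
    | zero => intro _; simp [S0]
    | succ t ih =>
      intro ht
      have hT := (hAB t (by omega)).1
      rw [List.range_succ, List.map_append, List.prod_append, ← mul_assoc, ← ih (by omega),
        wR_eq_V n (S (t + 1)) hT.rc.1, wR_eq_V n (S t) (good t (by omega)).1.1,
        hT.mul n (hrange t (by omega)).2]
      simp
  refine ⟨fun i => A (i - 1) n, fun i => B (i - 1) n, ?_, ?_, ?_, ?_⟩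
  · intro i h1 h2
    obtain ⟨t, rfl⟩ : ∃ t, i = t + 1 := ⟨i - 1, by omega⟩
    exact (hAB t (by omega)).1.pos n (hrange t (by omega)).2
  · intro i h1 h2
    obtain ⟨t, rfl⟩ : ∃ t, i = t + 1 := ⟨i - 1, by omega⟩
    have hk : (a (t + 1) : ℤ) ≤ (a (t + 1 + 1) : ℤ) := by exact_mod_cast hmono (t + 1) h1 h2
    exact two_insert n (S t) (S (t + 1)) (S (t + 1 + 1)) _ _ hk (good t (by omega)).1
      (good t (by omega)).2.1 (A t) (B t) (A (t + 1)) (B (t + 1)) (hAB t (by omega)).1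
      (hAB (t + 1) (by omega)).1 (hAB (t + 1) (by omega)).2 n (hrange (t + 1) (by omega)).2
  · intro m' hm'
    have h := prodEq m' hm'
    have hg := good m' hm'
    refine (congrArg len h).symm.trans ?_
    rw [hg.1.2, hR.2, hg.2.2]
  · exact prodEq m le_rfl

end RCGraphs
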